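/- Let m ≥ 3 be odd and assume k = 2n+1 is prime. Regard N_k as a (normal) subgroup of R_k. Then the Cayley graph on R_k/N_k with connection set {sN_k : s ∈ S_k} (vertices R_k/N_k, with gN_k adjacent to hN_k iff hg^{−1} ∈ S_k N_k/N_k) is a connected simple graph, regular of valency k, with exactly 2m^k vertices; it admits a group of automorphisms acting transitively on its vertices and on its ordered pairs of adjacent vertices (namely the group generated by right translations by R_k/N_k and the automorphism induced by B); and the cosets of the image of ⟨z⟩ in R_k/N_k form a system of blocks of imprimitivity of size m for this group. -/

import Mathlib

/-- The discrete Heisenberg group `H_k` (`k = 2n+1`), realized concretely on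
`(Fin n → ℤ) × (Fin n → ℤ) × ℤ`. -/
@[ext]
structure Heis (n : ℕ) where
  a : Fin n → ℤ
  b : Fin n → ℤ
  c : ℤ

namespace Heis

variable {n : ℕ}

instance : Mul (Heis n) :=
  ⟨fun g h => ⟨g.a + h.a, g.b + h.b, g.c + h.c + ∑ i, g.a i * h.b i⟩⟩

instance : One (Heis n) := ⟨⟨0, 0, 0⟩⟩

instance : Inv (Heis n) :=
  ⟨fun g => ⟨-g.a, -g.b, -g.c + ∑ i, g.a i * g.b i⟩⟩

@[simp] lemma mul_a (g h : Heis n) : (g * h).a = g.a + h.a := rfl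
@[simp] lemma mul_b (g h : Heis n) : (g * h).b = g.b + h.b := rfl
@[simp] lemma mul_c (g h : Heis n) :
    (g * h).c = g.c + h.c + ∑ i, g.a i * h.b i := rfl
@[simp] lemma one_a : (1 : Heis n).a = 0 := rfl
@[simp] lemma one_b : (1 : Heis n).b = 0 := rfl
@[simp] lemma one_c : (1 : Heis n).c = 0 := rfl
@[simp] lemma inv_a (g : Heis n) : g⁻¹.a = -g.a := rfl
@[simp] lemma inv_b (g : Heis n) : g⁻¹.b = -g.b := rfl
@[simp] lemma inv_c (g : Heis n) : g⁻¹.c = -g.c + ∑ i, g.a i * g.b i := rfl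

instance : Group (Heis n) where
  mul_assoc g h k := by
    ext <;> simp [Finset.sum_add_distrib, add_mul, mul_add] <;> ring
  one_mul g := by ext <;> simp
  mul_one g := by ext <;> simp
  inv_mul_cancel g := by
    ext <;> simp [Finset.sum_add_distrib, neg_mul] <;> ring

end Heis

/-- The generators `x_1, …, x_{2n}` of the Heisenberg group: for `1 ≤ i ≤ n`,
`x_i = (e_i, 0, 0)`; for `n+1 ≤ i ≤ 2n`, `x_i = (0, e_{i-n}, 0)`. -/
def xg (n : ℕ) (i : ℕ) : Heis n :=
  if h : 1 ≤ i ∧ i ≤ n then ⟨Pi.single (⟨i - 1, by omega⟩ : Fin n) 1, 0, 0⟩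
  else if h' : n + 1 ≤ i ∧ i ≤ 2 * n then
    ⟨0, Pi.single (⟨i - n - 1, by omega⟩ : Fin n) 1, 0⟩
  else 1

/-- The central element `z = (0,0,1)`. -/
def zz (n : ℕ) : Heis n := ⟨0, 0, 1⟩

/-- The automorphism `t : (a,b,c) ↦ (-a,-b,c)` of the Heisenberg group. -/
def tAut (n : ℕ) : MulAut (Heis n) where
  toFun g := ⟨-g.a, -g.b, g.c⟩
  invFun g := ⟨-g.a, -g.b, g.c⟩
  left_inv g := by ext <;> simp
  right_inv g := by ext <;> simp
  map_mul' g h := by ext <;> simp <;> ring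

/-- The subgroup `⟨t⟩` of `Aut(H_k)` generated by `t`. -/
abbrev tsub (n : ℕ) : Subgroup (MulAut (Heis n)) := Subgroup.zpowers (tAut n)

/-- The group `R_k = H_k ⋊ ⟨t⟩`. -/
abbrev RR (n : ℕ) := SemidirectProduct (Heis n) (tsub n) (tsub n).subtype

/-- The element `t` of `R_k`. -/
def tR (n : ℕ) : RR n := SemidirectProduct.inr ⟨tAut n, Subgroup.mem_zpowers _⟩

/-- The defining conditions for the automorphism `b` of `H_k`. -/
def IsB (n : ℕ) (b : MulAut (Heis n)) : Prop :=
  (∀ i : ℕ, 1 ≤ i → i ≤ n - 1 → b (xg n i) = xg n (i + 1) * xg n (n + 1)) ∧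
  (∀ i : ℕ, n ≤ i → i ≤ 2 * n - 1 → b (xg n i) = xg n (i + 1)) ∧
  b (xg n (2 * n)) =
    (xg n 1)⁻¹ * ((List.range n).map fun j => (xg n (n + 1 + j))⁻¹).prod

/-- The defining conditions for the automorphism `B` of `R_k` extending `b`. -/
def IsBR (n : ℕ) (b : MulAut (Heis n)) (B : MulAut (RR n)) : Prop :=
  (∀ h : Heis n, B (SemidirectProduct.inl h) = SemidirectProduct.inl (b h)) ∧
  B (tR n) = SemidirectProduct.inl (xg n (n + 1)) * tR n

/-- The generating set `{x_1^m, …, x_{2n}^m, z^m}` of the subgroup `N_k`. -/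
def Ngen (n m : ℕ) : Set (Heis n) :=
  {g | (∃ i : ℕ, 1 ≤ i ∧ i ≤ 2 * n ∧ g = xg n i ^ m) ∨ g = zz n ^ m}

/-- The subgroup `N_k = ⟨x_1^m, …, x_{2n}^m, z^m⟩` of `H_k`. -/
def Nsub (n m : ℕ) : Subgroup (Heis n) := Subgroup.closure (Ngen n m)

/-- The adjacency relation of the Cayley graph on `R_k/N` with connection set
the image of `S_k = {B^j(t) : 0 ≤ j ≤ k-1}`: `g ~ s·g` for `s` in the image of
`S_k`. -/
def SAdj (n k : ℕ) (B : MulAut (RR n)) (N : Subgroup (RR n)) [N.Normal]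
    (g h : RR n ⧸ N) : Prop :=
  ∃ j < k, h = (QuotientGroup.mk ((B ^ j) (tR n)) : RR n ⧸ N) * g

/-- The group of permutations of `R_k/N` generated by right translations
together with the automorphism induced by `B`. -/
def CayGrpR (n : ℕ) (B : MulAut (RR n)) (N : Subgroup (RR n)) [N.Normal]
    (hBN : Subgroup.map (B : RR n →* RR n) N = N) :
    Subgroup (Equiv.Perm (RR n ⧸ N)) :=
  Subgroup.closure
    (Set.range (fun h : RR n ⧸ N => Equiv.mulRight h) ∪
      {(QuotientGroup.congr N N (B : RR n ≃* RR n) hBN).toEquiv})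

/-- The coset of the image of `⟨z⟩` in `R_k/N` containing `g`. -/
def zCosetR (n : ℕ) (N : Subgroup (RR n)) [N.Normal] (g : RR n ⧸ N) :
    Set (RR n ⧸ N) :=
  {q | ∃ c : ℤ,
    q = (QuotientGroup.mk (SemidirectProduct.inl (zz n ^ c)) : RR n ⧸ N) * g}

namespace HeisAux

variable {n : ℕ}

lemma xg_lo (i : Fin n) : xg n (i + 1) = ⟨Pi.single i 1, 0, 0⟩ := by
  have h : 1 ≤ (i : ℕ) + 1 ∧ (i : ℕ) + 1 ≤ n := ⟨by omega, by omega⟩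
  simp [xg, h]

lemma xg_hi (i : Fin n) : xg n (n + 1 + i) = ⟨0, Pi.single i 1, 0⟩ := by
  have h : ¬ (1 ≤ n + 1 + (i : ℕ) ∧ n + 1 + (i : ℕ) ≤ n) := by omega
  have h' : n + 1 ≤ n + 1 + (i : ℕ) ∧ n + 1 + (i : ℕ) ≤ 2 * n := ⟨by omega, by omega⟩
  have h2 : n + 1 + (i : ℕ) - n - 1 = i := by omega
  simp only [xg, dif_neg h, dif_pos h', h2]

lemma pow_a (v : Fin n → ℤ) (d : ℕ) : (⟨v, 0, 0⟩ : Heis n) ^ d = ⟨(d : ℤ) • v, 0, 0⟩ := by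
  induction d with
  | zero => ext <;> simp
  | succ d ih => rw [pow_succ, ih]; ext <;> simp <;> ring

lemma pow_b (v : Fin n → ℤ) (d : ℕ) : (⟨0, v, 0⟩ : Heis n) ^ d = ⟨0, (d : ℤ) • v, 0⟩ := by
  induction d with
  | zero => ext <;> simp
  | succ d ih => rw [pow_succ, ih]; ext <;> simp <;> ring

lemma pow_z (c : ℤ) (d : ℕ) : (⟨0, 0, c⟩ : Heis n) ^ d = ⟨0, 0, d * c⟩ := by
  induction d with
  | zero => ext <;> simp
  | succ d ih => rw [pow_succ, ih]; ext <;> simp <;> ring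

lemma zpow_z (d : ℤ) (c : ℤ) : (⟨0, 0, d⟩ : Heis n) ^ c = ⟨0, 0, c * d⟩ := by
  obtain ⟨k, rfl | rfl⟩ := c.eq_nat_or_neg
  · rw [zpow_natCast, pow_z]
  · rw [zpow_neg, zpow_natCast, pow_z]; ext <;> simp

lemma zz_zpow (c : ℤ) : zz n ^ c = ⟨0, 0, c⟩ := by
  rw [zz, zpow_z]; simp

lemma addsub_top (A : AddSubgroup (Fin n → ℤ)) (h : ∀ i, Pi.single i 1 ∈ A) (v : Fin n → ℤ) :
    v ∈ A := by
  have : v = ∑ i, v i • (Pi.single i (1 : ℤ) : Fin n → ℤ) := by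
    ext j; simp [Finset.sum_apply, Pi.single_apply]
  rw [this]
  exact A.sum_mem fun i _ => A.zsmul_mem (h i) _

/-- A subgroup containing the `d`-th powers of generators contains everything divisible by `d`. -/
lemma mem_of_gens (K : Subgroup (Heis n)) (d : ℕ)
    (hx : ∀ i : ℕ, 1 ≤ i → i ≤ 2 * n → xg n i ^ d ∈ K) (hz : zz n ^ d ∈ K)
    (a b : Fin n → ℤ) (c : ℤ) : (⟨(d : ℤ) • a, (d : ℤ) • b, d * c⟩ : Heis n) ∈ K := by
  have ha : (⟨(d : ℤ) • a, 0, 0⟩ : Heis n) ∈ K := by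
    let A : AddSubgroup (Fin n → ℤ) :=
      { carrier := {v | (⟨(d : ℤ) • v, 0, 0⟩ : Heis n) ∈ K}
        zero_mem' := by
          have : (⟨(d : ℤ) • 0, 0, 0⟩ : Heis n) = 1 := by ext <;> simp
          simp only [Set.mem_setOf_eq, this]; exact K.one_mem
        add_mem' := by
          intro u v hu hv
          have := K.mul_mem hu hv
          have e : (⟨(d : ℤ) • (u + v), 0, 0⟩ : Heis n) = ⟨(d : ℤ) • u, 0, 0⟩ * ⟨(d : ℤ) • v, 0, 0⟩ := by
            ext <;> simp <;> ring
          simp only [Set.mem_setOf_eq, e]; exact this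
        neg_mem' := by
          intro u hu
          have := K.inv_mem hu
          have e : (⟨(d : ℤ) • (-u), 0, 0⟩ : Heis n) = (⟨(d : ℤ) • u, 0, 0⟩)⁻¹ := by
            ext <;> simp
          simp only [Set.mem_setOf_eq, e]; exact this }
    refine addsub_top A (fun i => ?_) a
    have := hx (i + 1) (by omega) (by omega)
    rwa [xg_lo, pow_a] at this
  have hb : (⟨0, (d : ℤ) • b, 0⟩ : Heis n) ∈ K := by
    let A : AddSubgroup (Fin n → ℤ) :=
      { carrier := {v | (⟨0, (d : ℤ) • v, 0⟩ : Heis n) ∈ K}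
        zero_mem' := by
          have : (⟨0, (d : ℤ) • 0, 0⟩ : Heis n) = 1 := by ext <;> simp
          simp only [Set.mem_setOf_eq, this]; exact K.one_mem
        add_mem' := by
          intro u v hu hv
          have := K.mul_mem hu hv
          have e : (⟨0, (d : ℤ) • (u + v), 0⟩ : Heis n) = ⟨0, (d : ℤ) • u, 0⟩ * ⟨0, (d : ℤ) • v, 0⟩ := by
            ext <;> simp <;> ring
          simp only [Set.mem_setOf_eq, e]; exact this
        neg_mem' := by
          intro u hu
          have := K.inv_mem hu
          have e : (⟨0, (d : ℤ) • (-u), 0⟩ : Heis n) = (⟨0, (d : ℤ) • u, 0⟩)⁻¹ := by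
            ext <;> simp
          simp only [Set.mem_setOf_eq, e]; exact this }
    refine addsub_top A (fun i => ?_) b
    have := hx (n + 1 + i) (by omega) (by omega)
    rwa [xg_hi, pow_b] at this
  have hc : (⟨0, 0, d * c⟩ : Heis n) ∈ K := by
    have := K.zpow_mem hz c
    rw [zz, pow_z, zpow_z] at this
    convert this using 2
    ring
  have e : (⟨(d : ℤ) • a, (d : ℤ) • b, d * c⟩ : Heis n) =
      ⟨0, (d : ℤ) • b, 0⟩ * ⟨(d : ℤ) • a, 0, 0⟩ * ⟨0, 0, d * c⟩ := by
    ext <;> simp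
  rw [e]
  exact K.mul_mem (K.mul_mem hb ha) hc

/-- The subgroup of elements with all coordinates divisible by `m`. -/
def dsub (n m : ℕ) : Subgroup (Heis n) where
  carrier := {g | (∀ i, (m : ℤ) ∣ g.a i) ∧ (∀ i, (m : ℤ) ∣ g.b i) ∧ (m : ℤ) ∣ g.c}
  one_mem' := by simp
  mul_mem' := by
    rintro g h ⟨h1, h2, h3⟩ ⟨h4, h5, h6⟩
    refine ⟨fun i => dvd_add (h1 i) (h4 i), fun i => dvd_add (h2 i) (h5 i), ?_⟩
    exact dvd_add (dvd_add h3 h6) (Finset.dvd_sum fun i _ => Dvd.dvd.mul_right (h1 i) _)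
  inv_mem' := by
    rintro g ⟨h1, h2, h3⟩
    refine ⟨fun i => (dvd_neg.2 (h1 i)), fun i => (dvd_neg.2 (h2 i)), ?_⟩
    exact dvd_add (dvd_neg.2 h3) (Finset.dvd_sum fun i _ => Dvd.dvd.mul_right (h1 i) _)

lemma xg_cases (i : ℕ) (h1 : 1 ≤ i) (h2 : i ≤ 2 * n) :
    (∃ j : Fin n, i = j + 1) ∨ ∃ j : Fin n, i = n + 1 + j := by
  by_cases h : i ≤ n
  · exact Or.inl ⟨⟨i - 1, by omega⟩, by simp; omega⟩
  · exact Or.inr ⟨⟨i - n - 1, by omega⟩, by simp; omega⟩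

lemma Nsub_eq (m : ℕ) : Nsub n m = dsub n m := by
  apply le_antisymm
  · rw [Nsub, Subgroup.closure_le]
    rintro g (⟨i, h1, h2, rfl⟩ | rfl)
    · rcases xg_cases i h1 h2 with ⟨j, rfl⟩ | ⟨j, rfl⟩
      · rw [xg_lo, pow_a]; refine ⟨fun i => ?_, ?_, ?_⟩ <;> simp
      · rw [xg_hi, pow_b]; refine ⟨?_, fun i => ?_, ?_⟩ <;> simp
    · rw [zz, pow_z]; refine ⟨?_, ?_, ?_⟩ <;> simp
  · rintro ⟨a, b, c⟩ ⟨h1, h2, h3⟩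
    choose a' ha' using h1
    choose b' hb' using h2
    obtain ⟨c', hc'⟩ := h3
    have := mem_of_gens (Nsub n m) m
      (fun i h1 h2 => Subgroup.subset_closure (Or.inl ⟨i, h1, h2, rfl⟩))
      (Subgroup.subset_closure (Or.inr rfl)) a' b' c'
    convert this using 2
    · ext i; simpa using ha' i
    · ext i; simpa using hb' i

/-- Coordinatewise congruence modulo `m`. -/
def Cong (m : ℕ) (g h : Heis n) : Prop :=
  (∀ i, (m : ℤ) ∣ h.a i - g.a i) ∧ (∀ i, (m : ℤ) ∣ h.b i - g.b i) ∧ (m : ℤ) ∣ h.c - g.c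

lemma inv_mul_mem (m : ℕ) (g h : Heis n) : g⁻¹ * h ∈ Nsub n m ↔ Cong m g h := by
  rw [Nsub_eq]
  have e1 : ∀ i, (g⁻¹ * h).a i = h.a i - g.a i := fun i => by simp; ring
  have e2 : ∀ i, (g⁻¹ * h).b i = h.b i - g.b i := fun i => by simp; ring
  have e3 : (g⁻¹ * h).c = (h.c - g.c) - ∑ i, g.a i * (h.b i - g.b i) := by
    simp [mul_sub, Finset.sum_sub_distrib]; ring
  change ((∀ i, (m : ℤ) ∣ (g⁻¹ * h).a i) ∧ (∀ i, (m : ℤ) ∣ (g⁻¹ * h).b i) ∧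
    (m : ℤ) ∣ (g⁻¹ * h).c) ↔ _
  simp only [e1, e2, e3, Cong]
  refine and_congr_right fun _ => and_congr_right fun h2 => ?_
  exact dvd_sub_left (Finset.dvd_sum fun i _ => Dvd.dvd.mul_left (h2 i) _)

lemma tAut_sq : tAut n * tAut n = 1 := by
  ext g <;> simp [tAut]

lemma tsub_cases (s : tsub n) : (s : MulAut (Heis n)) = 1 ∨ (s : MulAut (Heis n)) = tAut n := by
  obtain ⟨s, c, rfl⟩ := s
  have h2 : tAut n ^ (2 : ℤ) = 1 := by rw [zpow_ofNat, pow_two, tAut_sq]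
  rcases Int.even_or_odd' c with ⟨d, rfl | rfl⟩
  · left; simp [zpow_mul, h2]
  · right; simp [zpow_add, zpow_mul, h2]

lemma tAut_ne (hn : 1 ≤ n) : tAut n ≠ 1 := by
  intro h
  have := congrArg (fun f : MulAut (Heis n) =>
    (f (⟨fun _ => 1, 0, 0⟩ : Heis n)).a ⟨0, hn⟩) h
  simp [tAut] at this

lemma card_tsub (hn : 1 ≤ n) : Nat.card (tsub n) = 2 := by
  rw [Nat.card_zpowers]
  exact orderOf_eq_prime (by rw [pow_two, tAut_sq]) (tAut_ne hn)

lemma tsub_mem (m : ℕ) (s : tsub n) (g : Heis n) :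
    (s : MulAut (Heis n)) g ∈ Nsub n m ↔ g ∈ Nsub n m := by
  rcases tsub_cases s with h | h
  · rw [h]; rfl
  · rw [h, Nsub_eq]
    change ((∀ i, (m : ℤ) ∣ -g.a i) ∧ (∀ i, (m : ℤ) ∣ -g.b i) ∧ (m : ℤ) ∣ g.c) ↔
      ((∀ i, (m : ℤ) ∣ g.a i) ∧ (∀ i, (m : ℤ) ∣ g.b i) ∧ (m : ℤ) ∣ g.c)
    simp

lemma mk_eq (m : ℕ) (N : Subgroup (RR n))
    (hN : N = Subgroup.map SemidirectProduct.inl (Nsub n m)) (r r' : RR n) :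
    (QuotientGroup.mk r : RR n ⧸ N) = QuotientGroup.mk r' ↔
      r.right = r'.right ∧ Cong m r.left r'.left := by
  rw [QuotientGroup.eq, hN, Subgroup.mem_map, ← inv_mul_mem, ← tsub_mem m (r.right⁻¹)]
  have e1 : (r⁻¹ * r').left = ((r.right⁻¹ : tsub n) : MulAut (Heis n)) (r.left⁻¹ * r'.left) := by
    simp
  have e2 : (r⁻¹ * r').right = r.right⁻¹ * r'.right := by simp
  rw [← e1]
  constructor
  · rintro ⟨x, hx, hxr⟩
    have h1 := congrArg SemidirectProduct.left hxr
    have h2 := congrArg SemidirectProduct.right hxr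
    rw [SemidirectProduct.left_inl] at h1
    rw [SemidirectProduct.right_inl, e2] at h2
    exact ⟨(inv_mul_eq_one.1 h2.symm), h1 ▸ hx⟩
  · rintro ⟨h1, h2⟩
    refine ⟨_, h2, ?_⟩
    ext1
    · rw [SemidirectProduct.left_inl]
    · rw [SemidirectProduct.right_inl, e2, h1, inv_mul_cancel]

lemma card_quot (m : ℕ) (hm : 3 ≤ m) (hn : 1 ≤ n) (N : Subgroup (RR n))
    (hN : N = Subgroup.map SemidirectProduct.inl (Nsub n m)) :
    Nat.card (RR n ⧸ N) = 2 * m ^ (2 * n + 1) := by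
  haveI : NeZero m := ⟨by omega⟩
  let f : RR n → tsub n × (Fin n → ZMod m) × (Fin n → ZMod m) × ZMod m := fun r =>
    (r.right, fun i => (r.left.a i : ZMod m), fun i => (r.left.b i : ZMod m), (r.left.c : ZMod m))
  have hf : ∀ r r', f r = f r' ↔ (QuotientGroup.mk r : RR n ⧸ N) = QuotientGroup.mk r' := by
    intro r r'
    rw [mk_eq m N hN]
    simp only [f, Prod.mk.injEq, funext_iff, Cong, ZMod.intCast_eq_intCast_iff_dvd_sub]
  let F : RR n ⧸ N → tsub n × (Fin n → ZMod m) × (Fin n → ZMod m) × ZMod m :=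
    fun q => f q.out
  have hF : Function.Bijective F := by
    constructor
    · intro p q h
      have := (hf _ _).1 h
      simpa using this
    · rintro ⟨s, a, b, c⟩
      refine ⟨QuotientGroup.mk ⟨⟨fun i => (a i).val, fun i => (b i).val, c.val⟩, s⟩, ?_⟩
      have := (hf _ _).2 (QuotientGroup.out_eq'
        (QuotientGroup.mk ⟨⟨fun i => (a i).val, fun i => (b i).val, c.val⟩, s⟩ : RR n ⧸ N))
      change f _ = _
      rw [this]
      simp [f]
  rw [Nat.card_congr (Equiv.ofBijective F hF)]
  simp only [Nat.card_prod, card_tsub hn, Nat.card_pi, Nat.card_zmod, Finset.prod_const,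
    Finset.card_univ, Fintype.card_fin]
  ring

/-- The element `x_{n+j} ⋯ x_{n+1}`. -/
def Q (n j : ℕ) : Heis n := ⟨0, fun i => if (i : ℕ) < j then 1 else 0, 0⟩

lemma Q_zero : Q n 0 = 1 := by ext <;> simp [Q]

lemma Q_succ (j : ℕ) (hj : j < n) : xg n (n + 1 + j) * Q n j = Q n (j + 1) := by
  have := xg_hi (⟨j, hj⟩ : Fin n)
  simp only at this
  rw [this]
  ext i
  · simp [Q]
  · simp only [Q, Heis.mul_b, Pi.add_apply, Pi.single_apply, Fin.ext_iff]
    split_ifs <;> omega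
  · simp [Q]

lemma list_prod (j : ℕ) (hj : j ≤ n) :
    ((List.range j).map fun j => (xg n (n + 1 + j))⁻¹).prod = (Q n j)⁻¹ := by
  induction j with
  | zero => simp [Q_zero]
  | succ j ih =>
    rw [List.range_succ, List.map_append, List.prod_append, ih (by omega), ← Q_succ j (by omega)]
    simp

lemma b_Q (b : MulAut (Heis n)) (hb : IsB n b) (j : ℕ) (hj : j < n) :
    b (Q n j) * xg n (n + 1) = Q n (j + 1) := by
  induction j with
  | zero => 
    rw [← Q_succ 0 hj, Q_zero]; simp
  | succ j ih =>
    rw [← Q_succ j (by omega), map_mul, mul_assoc, ih (by omega), hb.2.1 _ (by omega) (by omega),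
      ← Q_succ (j+1) hj]
    rfl

lemma b_Qn (hn : 1 ≤ n) (b : MulAut (Heis n)) (hb : IsB n b) :
    b (Q n n) * xg n (n + 1) = (xg n 1)⁻¹ := by
  obtain ⟨j, rfl⟩ : ∃ j, n = j + 1 := ⟨n - 1, by omega⟩
  have h : xg (j+1) (j + 1 + 1 + j) * Q (j+1) j = Q (j+1) (j + 1) := Q_succ j (by omega)
  have e : j + 1 + 1 + j = 2 * (j + 1) := by omega
  conv_lhs => rw [← h]
  rw [map_mul, mul_assoc, b_Q b hb j (by omega), e, hb.2.2, list_prod _ le_rfl]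
  simp

lemma b_x (b : MulAut (Heis n)) (hb : IsB n b) (i : ℕ) (h1 : 1 ≤ i) (hi : i < n) :
    b (xg n i)⁻¹ * xg n (n + 1) = (xg n (i + 1))⁻¹ := by
  rw [map_inv, hb.1 i h1 (by omega)]
  have e1 := xg_lo (⟨i, hi⟩ : Fin n)
  have e2 := xg_hi (⟨0, by omega⟩ : Fin n)
  simp only [add_zero] at e1 e2
  rw [e1, e2]
  ext j
  · simp
  · simp
  · simp [Pi.single_apply]; omega

lemma b_xn (hn : 1 ≤ n) (b : MulAut (Heis n)) (hb : IsB n b) :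
    b (xg n n)⁻¹ * xg n (n + 1) = 1 := by
  rw [map_inv, hb.2.1 n le_rfl (by omega)]; simp

/-- The left component of `B^j(t)`. -/
def P (n j : ℕ) : Heis n := if j ≤ n then Q n j else (xg n (j - n))⁻¹

lemma b_P (hn : 1 ≤ n) (b : MulAut (Heis n)) (hb : IsB n b) (j : ℕ) (hj : j < 2 * n) :
    b (P n j) * xg n (n + 1) = P n (j + 1) := by
  rcases lt_trichotomy j n with h | h | h
  · rw [P, P, if_pos h.le, if_pos (by omega), b_Q b hb j h]
  · subst h
    rw [P, P, if_pos le_rfl, if_neg (by omega), b_Qn hn b hb]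
    simp
  · rw [P, P, if_neg (by omega), if_neg (by omega), b_x b hb _ (by omega) (by omega)]
    congr 2; omega

variable (hn : 1 ≤ n) (b : MulAut (Heis n)) (hb : IsB n b) (B : MulAut (RR n)) (hB : IsBR n b B)

lemma B_inl_t (hB : IsBR n b B) (g : Heis n) : B (SemidirectProduct.inl g * tR n) =
    SemidirectProduct.inl (b g * xg n (n + 1)) * tR n := by
  rw [map_mul, hB.1, hB.2, map_mul, mul_assoc]

lemma B_pow (hn : 1 ≤ n) (hb : IsB n b) (hB : IsBR n b B) (j : ℕ) (hj : j ≤ 2 * n) :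
    (B ^ j) (tR n) = SemidirectProduct.inl (P n j) * tR n := by
  induction j with
  | zero => simp [P, Q_zero]
  | succ j ih =>
    rw [pow_succ', MulAut.mul_apply, ih (by omega), B_inl_t b B hB, b_P hn b hb j (by omega)]

lemma B_k (hn : 1 ≤ n) (hb : IsB n b) (hB : IsBR n b B) :
    (B ^ (2 * n + 1)) (tR n) = tR n := by
  rw [pow_succ', MulAut.mul_apply, B_pow b B hn hb hB _ le_rfl, B_inl_t b B hB, P,
    if_neg (by omega)]
  have : 2 * n - n = n := by omega
  rw [this, b_xn hn b hb]; simp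

lemma B_mod (hn : 1 ≤ n) (hb : IsB n b) (hB : IsBR n b B) (j : ℕ) :
    (B ^ j) (tR n) = (B ^ (j % (2 * n + 1))) (tR n) := by
  have h : ∀ q : ℕ, ((B ^ (2 * n + 1)) ^ q) (tR n) = tR n := by
    intro q
    induction q with
    | zero => rfl
    | succ q ih => rw [pow_succ, MulAut.mul_apply, B_k b B hn hb hB, ih]
  conv_lhs => rw [← Nat.mod_add_div j (2 * n + 1), pow_add, MulAut.mul_apply, pow_mul, h]

lemma tR_sq : tR n * tR n = 1 := by
  rw [tR, ← map_mul, ← map_one (SemidirectProduct.inr : _ →* RR n)]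
  congr 1
  exact Subtype.ext tAut_sq

lemma xgn1 (hn : 1 ≤ n) : xg n (n + 1) = ⟨0, Pi.single ⟨0, hn⟩ 1, 0⟩ := by
  have := xg_hi (⟨0, hn⟩ : Fin n)
  simpa using this

lemma P_inj (m : ℕ) (hm : 3 ≤ m) (i j : ℕ) (hij : i < j) (hj : j ≤ 2 * n) :
    ¬ Cong m (P n i) (P n j) := by
  have h1 : ¬ (m : ℤ) ∣ 1 := by
    intro h
    have := Int.le_of_dvd (by norm_num) h
    omega
  rintro ⟨ha, hb, -⟩
  by_cases hjn : j ≤ n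
  · have := hb ⟨i, by omega⟩
    rw [P, P, if_pos hjn, if_pos (by omega)] at this
    simp [Q, hij] at this
    omega
  · have h := ha ⟨j - n - 1, by omega⟩
    have e := xg_lo (⟨j - n - 1, by omega⟩ : Fin n)
    have e' : j - n - 1 + 1 = j - n := by omega
    simp only [e'] at e
    rw [P, if_neg hjn, e, P] at h
    split_ifs at h with hi
    · simp [Q] at h; omega
    · have e2 := xg_lo (⟨i - n - 1, by omega⟩ : Fin n)
      have e2' : i - n - 1 + 1 = i - n := by omega
      simp only [e2'] at e2
      rw [e2] at h
      have hne : j - n - 1 ≠ i - n - 1 := by omega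
      simp [Pi.single_apply, hne] at h
      omega

lemma center_iff (hn : 1 ≤ n) (g : Heis n) : g ∈ Subgroup.center (Heis n) ↔ ∃ c : ℤ, g = zz n ^ c := by
  constructor
  · intro h
    rw [Subgroup.mem_center_iff] at h
    refine ⟨g.c, ?_⟩
    rw [zz_zpow]
    ext i
    · have := congrArg Heis.c (h ⟨0, Pi.single i 1, 0⟩)
      simp [Pi.single_apply] at this
      simpa using this
    · have := congrArg Heis.c (h ⟨Pi.single i 1, 0, 0⟩)
      simp [Pi.single_apply] at this
      simpa using this
    · rfl
  · rintro ⟨c, rfl⟩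
    rw [Subgroup.mem_center_iff, zz_zpow]
    intro g
    ext <;> simp <;> ring

lemma b_center (hn : 1 ≤ n) (b : MulAut (Heis n)) (c : ℤ) : ∃ d : ℤ, b (zz n ^ c) = zz n ^ d := by
  rw [← center_iff hn]
  have h := (center_iff hn _).2 ⟨c, rfl⟩
  rw [Subgroup.mem_center_iff] at h ⊢
  intro g
  have := congrArg b (h (b.symm g))
  simpa using this

lemma closure_top (hn : 1 ≤ n) (hb : IsB n b) (hB : IsBR n b B) (K : Subgroup (RR n))
    (hK : ∀ j < 2 * n + 1, (B ^ j) (tR n) ∈ K) (g : RR n) : g ∈ K := by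
  have ht : tR n ∈ K := by simpa using hK 0 (by omega)
  have hP : ∀ j, j ≤ 2 * n → P n j ∈ K.comap SemidirectProduct.inl := by
    intro j hj
    have := hK j (by omega)
    rw [B_pow b B hn hb hB j hj] at this
    exact (K.mul_mem_cancel_right ht).1 this
  set K' := K.comap (SemidirectProduct.inl : Heis n →* RR n) with hK'
  have hx : ∀ i : ℕ, 1 ≤ i → i ≤ 2 * n → xg n i ^ 1 ∈ K' := by
    intro i h1 h2
    rw [pow_one]
    rcases xg_cases i h1 h2 with ⟨j, rfl⟩ | ⟨j, rfl⟩
    · have := hP (n + (j + 1)) (by omega)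
      rw [P, if_neg (by omega), Nat.add_sub_cancel_left] at this
      exact K'.inv_mem_iff.1 this
    · have h1 := hP j (by omega)
      have h2 := hP (j + 1) (by omega)
      rw [P, if_pos (by omega)] at h1 h2
      rw [← Q_succ _ j.2] at h2
      exact (K'.mul_mem_cancel_right h1).1 h2
  have hz : zz n ^ 1 ∈ K' := by
    have h1 := hx 1 (by omega) (by omega)
    have h2 := hx (n + 1) (by omega) (by omega)
    rw [pow_one] at h1 h2 ⊢
    have e1 := xg_lo (⟨0, hn⟩ : Fin n)
    simp only [zero_add] at e1
    have h3 := K'.mul_mem (K'.inv_mem (K'.mul_mem h2 h1)) (K'.mul_mem h1 h2)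
    rw [e1, xgn1 hn] at h3
    convert h3 using 1
    ext <;> simp [zz, Pi.single_apply]
  have hl : ∀ h : Heis n, (SemidirectProduct.inl h : RR n) ∈ K := by
    intro h
    have := mem_of_gens K' 1 hx hz h.a h.b h.c
    have e : h ∈ K' := by simpa using this
    exact e
  rw [← SemidirectProduct.inl_left_mul_inr_right g]
  refine K.mul_mem (hl _) ?_
  rcases tsub_cases g.right with h | h
  · have : g.right = 1 := Subtype.ext h
    rw [this, map_one]; exact K.one_mem
  · have : g.right = ⟨tAut n, Subgroup.mem_zpowers _⟩ := Subtype.ext h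
    rw [this]; exact ht

end HeisAux

open HeisAux

/-- For odd `m ≥ 3` and `k = 2n+1` prime, with `N_k` regarded as a normal
subgroup of `R_k`: the Cayley graph on `R_k/N_k` with connection set the image
of `S_k` is a connected simple graph, regular of valency `k`, with exactly
`2·m^k` vertices; the group generated by right translations and the
automorphism induced by `B` preserves adjacency and acts transitively on
vertices and on ordered pairs of adjacent vertices; and the cosets of the
image of `⟨z⟩` form a system of blocks of imprimitivity of size `m` for this
group. -/
theorem odd_case_graph (n m k : ℕ) (hn : 1 ≤ n) (hk : k = 2 * n + 1)
    (hp : Nat.Prime k) (hm : 3 ≤ m) (hmo : Odd m)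
    (b : MulAut (Heis n)) (hb : IsB n b)
    (B : MulAut (RR n)) (hB : IsBR n b B)
    (N : Subgroup (RR n))
    (hN : N = Subgroup.map SemidirectProduct.inl (Nsub n m)) [N.Normal]
    (hBN : Subgroup.map (B : RR n →* RR n) N = N) :
    (∀ u v : RR n ⧸ N, SAdj n k B N u v → SAdj n k B N v u) ∧
    (∀ u : RR n ⧸ N, ¬ SAdj n k B N u u) ∧
    (∀ u v : RR n ⧸ N, Relation.EqvGen (SAdj n k B N) u v) ∧
    (∀ u : RR n ⧸ N, {v | SAdj n k B N u v}.ncard = k) ∧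
    Nat.card (RR n ⧸ N) = 2 * m ^ k ∧
    (∀ σ ∈ CayGrpR n B N hBN, ∀ u v : RR n ⧸ N,
      SAdj n k B N u v → SAdj n k B N (σ u) (σ v)) ∧
    (∀ u v : RR n ⧸ N, ∃ σ ∈ CayGrpR n B N hBN, σ u = v) ∧
    (∀ u v u' v' : RR n ⧸ N, SAdj n k B N u v → SAdj n k B N u' v' →
      ∃ σ ∈ CayGrpR n B N hBN, σ u = u' ∧ σ v = v') ∧
    (∀ g : RR n ⧸ N, (zCosetR n N g).ncard = m) ∧
    (∀ σ ∈ CayGrpR n B N hBN, ∀ g : RR n ⧸ N,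
      ∃ g' : RR n ⧸ N, σ '' zCosetR n N g = zCosetR n N g') := by
  subst hk
  have hkpos : 0 < 2 * n + 1 := by omega
  have ht : (tR n).right ≠ 1 := fun h => tAut_ne hn (congrArg Subtype.val h)
  have hpow : ∀ j < 2 * n + 1, (B ^ j) (tR n) = SemidirectProduct.inl (P n j) * tR n :=
    fun j hj => B_pow b B hn hb hB j (by omega)
  have hleft : ∀ g : Heis n, (SemidirectProduct.inl g * tR n : RR n).left = g := by
    intro g; simp [tR]
  have hright : ∀ g : Heis n, (SemidirectProduct.inl g * tR n : RR n).right = (tR n).right := by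
    intro g; simp
  have hsq : ∀ j, (B ^ j) (tR n) * (B ^ j) (tR n) = 1 := by
    intro j; rw [← map_mul, tR_sq, map_one]
  -- adjacency for arbitrary exponent
  have hadj : ∀ (j : ℕ) (g : RR n ⧸ N),
      SAdj n (2 * n + 1) B N g ((QuotientGroup.mk ((B ^ j) (tR n)) : RR n ⧸ N) * g) := by
    intro j g
    exact ⟨j % (2 * n + 1), Nat.mod_lt _ hkpos, by rw [← B_mod b B hn hb hB]⟩
  set Bb := QuotientGroup.congr N N (B : RR n ≃* RR n) hBN with hBb
  have hBmk : ∀ r : RR n, Bb (QuotientGroup.mk r) = QuotientGroup.mk (B r) := fun r => rfl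
  have hBmem : Bb.toEquiv ∈ CayGrpR n B N hBN :=
    Subgroup.subset_closure (Or.inr rfl)
  have hRmem : ∀ h : RR n ⧸ N, Equiv.mulRight h ∈ CayGrpR n B N hBN :=
    fun h => Subgroup.subset_closure (Or.inl ⟨h, rfl⟩)
  have hBadj : ∀ u v, SAdj n (2 * n + 1) B N u v ↔
      SAdj n (2 * n + 1) B N (Bb u) (Bb v) := by
    intro u v
    constructor
    · rintro ⟨j, hj, rfl⟩
      rw [map_mul, hBmk, ← MulAut.mul_apply, ← pow_succ']
      exact hadj _ _
    · rintro ⟨j, hj, h⟩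
      have : v = (QuotientGroup.mk ((B ^ (j + 2 * n)) (tR n)) : RR n ⧸ N) * u := by
        apply Bb.injective
        rw [h, map_mul, hBmk, ← MulAut.mul_apply, ← pow_succ', add_assoc,
          B_mod b B hn hb hB (j + _), Nat.add_mod_right, ← B_mod b B hn hb hB]
      rw [this]; exact hadj _ _
  have hpres : ∀ σ ∈ CayGrpR n B N hBN, ∀ u v : RR n ⧸ N,
      SAdj n (2 * n + 1) B N u v ↔ SAdj n (2 * n + 1) B N (σ u) (σ v) := by
    intro σ hσ
    refine Subgroup.closure_induction (p := fun σ _ => ∀ u v : RR n ⧸ N,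
      SAdj n (2 * n + 1) B N u v ↔ SAdj n (2 * n + 1) B N (σ u) (σ v)) ?_ ?_ ?_ ?_ hσ
    · rintro _ (⟨h, rfl⟩ | rfl) u v
      · simp only [SAdj, Equiv.coe_mulRight, ← mul_assoc, mul_left_inj]
      · exact hBadj u v
    · intro u v; rfl
    · intro x y _ _ hx hy u v
      rw [hy, hx]; rfl
    · intro x _ hx u v
      rw [hx (x⁻¹ u) (x⁻¹ v)]; simp
  have hbase : ∀ u v : RR n ⧸ N, SAdj n (2 * n + 1) B N u v → ∃ σ ∈ CayGrpR n B N hBN,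
      σ 1 = u ∧ σ (QuotientGroup.mk (tR n)) = v := by
    rintro u v ⟨j, hj, rfl⟩
    have hj : ∀ j : ℕ, (Bb.toEquiv ^ j) 1 = 1 ∧
        (Bb.toEquiv ^ j) (QuotientGroup.mk (tR n)) = QuotientGroup.mk ((B ^ j) (tR n)) := by
      intro j
      induction j with
      | zero => exact ⟨rfl, rfl⟩
      | succ j ih =>
        rw [pow_succ', Equiv.Perm.mul_apply, Equiv.Perm.mul_apply, ih.1, ih.2]
        refine ⟨map_one Bb, ?_⟩
        rw [pow_succ' B, MulAut.mul_apply]; rfl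
    refine ⟨Equiv.mulRight u * Bb.toEquiv ^ j,
      Subgroup.mul_mem _ (hRmem u) (Subgroup.pow_mem _ hBmem j), ?_, ?_⟩
    · rw [Equiv.Perm.mul_apply, (hj j).1]; simp
    · rw [Equiv.Perm.mul_apply, (hj j).2]; simp
  refine ⟨?_, ?_, ?_, ?_, card_quot m hm hn N hN, fun σ hσ u v => (hpres σ hσ u v).1,
    ?_, ?_, ?_, ?_⟩
  · rintro u v ⟨j, hj, rfl⟩
    refine ⟨j, hj, ?_⟩
    rw [← mul_assoc, ← QuotientGroup.mk_mul, hsq]; simp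
  · rintro u ⟨j, hj, h⟩
    have h := (mul_eq_right.1 h.symm)
    rw [← QuotientGroup.mk_one, mk_eq m N hN, hpow j hj, hright] at h
    exact ht h.1
  · intro u v
    let K : Subgroup (RR n) :=
      { carrier := {r | ∀ u : RR n ⧸ N, Relation.EqvGen (SAdj n (2 * n + 1) B N) u
          ((QuotientGroup.mk r : RR n ⧸ N) * u)}
        one_mem' := fun u => by
          rw [QuotientGroup.mk_one, one_mul]; exact Relation.EqvGen.refl _
        mul_mem' := fun {r s} hr hs u => by
          rw [QuotientGroup.mk_mul, mul_assoc]
          exact (hs u).trans _ _ _ (hr _)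
        inv_mem' := fun {r} hr u => by
          have := hr ((QuotientGroup.mk r⁻¹ : RR n ⧸ N) * u)
          rw [← mul_assoc, ← QuotientGroup.mk_mul, mul_inv_cancel, QuotientGroup.mk_one,
            one_mul] at this
          exact this.symm _ _ }
    obtain ⟨r, hr⟩ := QuotientGroup.mk_surjective (v * u⁻¹)
    have : r ∈ K := closure_top b B hn hb hB K
      (fun j hj u => Relation.EqvGen.rel _ _ (hadj j u)) r
    have := this u
    rw [hr] at this
    simpa using this
  · intro u
    have e : {v | SAdj n (2 * n + 1) B N u v} =
        (fun j : ℕ => (QuotientGroup.mk ((B ^ j) (tR n)) : RR n ⧸ N) * u) ''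
          (Finset.range (2 * n + 1) : Set ℕ) := by
      ext v
      simp only [SAdj, Set.mem_setOf_eq, Set.mem_image, Finset.coe_range, Set.mem_Iio]
      exact exists_congr fun j => and_congr_right fun _ => eq_comm
    have hne : ∀ i j, i < j → j < 2 * n + 1 → (QuotientGroup.mk ((B ^ i) (tR n)) : RR n ⧸ N) ≠
        QuotientGroup.mk ((B ^ j) (tR n)) := by
      intro i j hij hj h
      rw [mk_eq m N hN, hpow i (by omega), hpow j hj, hleft, hleft] at h
      exact P_inj m hm i j hij (by omega) h.2
    rw [e, Set.ncard_image_of_injOn, Set.ncard_coe_finset, Finset.card_range]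
    intro i hi j hj hij
    simp only [Finset.coe_range, Set.mem_Iio] at hi hj
    have hij := mul_right_cancel hij
    rcases lt_trichotomy i j with h | h | h
    · exact absurd hij (hne i j h hj)
    · exact h
    · exact absurd hij.symm (hne j i h hi)
  · intro u v
    exact ⟨Equiv.mulRight (u⁻¹ * v), hRmem _, by simp⟩
  · intro u v u' v' h h'
    obtain ⟨σ, hσ, h1, h2⟩ := hbase u v h
    obtain ⟨τ, hτ, h3, h4⟩ := hbase u' v' h'
    refine ⟨τ * σ⁻¹, Subgroup.mul_mem _ hτ (Subgroup.inv_mem _ hσ), ?_, ?_⟩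
    · rw [← h1, ← h3]; simp
    · rw [← h2, ← h4]; simp
  · intro g
    have hzeq : ∀ c d : ℤ, (QuotientGroup.mk (SemidirectProduct.inl (zz n ^ c)) : RR n ⧸ N) =
        QuotientGroup.mk (SemidirectProduct.inl (zz n ^ d)) ↔ (m : ℤ) ∣ d - c := by
      intro c d
      rw [mk_eq m N hN]
      simp [zz_zpow, Cong]
    have e : zCosetR n N g = (fun j : ℕ =>
        (QuotientGroup.mk (SemidirectProduct.inl (zz n ^ (j : ℤ))) : RR n ⧸ N) * g) ''
          (Finset.range m : Set ℕ) := by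
      ext v
      simp only [zCosetR, Set.mem_setOf_eq, Set.mem_image, Finset.coe_range, Set.mem_Iio]
      constructor
      · rintro ⟨c, rfl⟩
        have h0 : (0 : ℤ) ≤ c % m := Int.emod_nonneg _ (by omega)
        have h1 : c % m < m := Int.emod_lt_of_pos _ (by omega)
        refine ⟨(c % m).toNat, by omega, ?_⟩
        rw [Int.toNat_of_nonneg h0]
        congr 1
        rw [hzeq]
        exact Int.dvd_self_sub_emod
      · rintro ⟨j, _, rfl⟩
        exact ⟨j, rfl⟩
    rw [e, Set.ncard_image_of_injOn, Set.ncard_coe_finset, Finset.card_range]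
    intro i hi j hj hij
    simp only [Finset.coe_range, Set.mem_Iio] at hi hj
    have hij := (hzeq _ _).1 (mul_right_cancel hij)
    have := Int.eq_zero_of_abs_lt_dvd hij (by rw [abs_lt]; constructor <;> omega)
    omega
  · intro σ hσ g
    refine ⟨σ g, ?_⟩
    revert g
    refine Subgroup.closure_induction (p := fun (σ : Equiv.Perm (RR n ⧸ N)) _ => ∀ g : RR n ⧸ N,
      σ '' zCosetR n N g = zCosetR n N (σ g)) ?_ ?_ ?_ ?_ hσ
    · rintro _ (⟨h, rfl⟩ | rfl) g
      · ext q
        constructor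
        · rintro ⟨_, ⟨c, rfl⟩, rfl⟩
          exact ⟨c, by simp [mul_assoc]⟩
        · rintro ⟨c, rfl⟩
          exact ⟨_, ⟨c, rfl⟩, by simp [mul_assoc]⟩
      · ext q
        constructor
        · rintro ⟨_, ⟨c, rfl⟩, rfl⟩
          obtain ⟨d, hd⟩ := b_center hn b c
          refine ⟨d, ?_⟩
          change Bb _ = _ * Bb g
          rw [map_mul, hBmk, hB.1, hd]
        · rintro ⟨c, rfl⟩
          obtain ⟨d, hd⟩ := b_center hn b⁻¹ c
          refine ⟨_, ⟨d, rfl⟩, ?_⟩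
          change Bb _ = _ * Bb g
          rw [map_mul, hBmk, hB.1, ← hd]
          simp
    · intro g; simp
    · intro x y _ _ hx hy g
      rw [Equiv.Perm.coe_mul, Set.image_comp, hy, hx]; rfl
    · intro x _ hx g
      have := hx (x⁻¹ g)
      have hxx : x (x⁻¹ g) = g := by simp
      rw [hxx] at this
      rw [← this, ← Set.image_comp]
      have : (⇑x⁻¹ ∘ ⇑x) = id := by ext; simp
      rw [this, Set.image_id]
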